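/- arXiv:1308.1186 — 7 statements merged into one kernel-verified Lean document; each statement's English description precedes it below -/
import Mathlib

section
/- Let G be a group, H a normal subgroup of G, and α = (α^{(t)})_{t ∈ ℕ} a sequence of finitely supported functions α^{(t)} : G → ℂ. Define r_H(α^{(t)}) : G/H → ℂ by (r_H α^{(t)})([g]) = ∑_{h ∈ H} α^{(t)}(gh). Then the pullback map s ↦ (t ↦ s^{(t)} ∘ π_H) is a ℂ-linear bijection from the set of solutions of the automaton on G/H determined by (r_H α^{(t)})_{t ∈ ℕ} onto the set of H-periodic solutions of the automaton on G determined by α. -/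
open scoped BigOperators

/-- Convolution on `G` of a finitely supported function with an arbitrary function:
`(a ⋆ f) g = ∑_{h ∈ G} a h * f (h⁻¹ * g)` (a finite sum over the support of `a`). -/
noncomputable def conv {G : Type*} [Group G] (a : G →₀ ℂ) (f : G → ℂ) : G → ℂ :=
  fun g => ∑ h ∈ a.support, a h * f (h⁻¹ * g)

/-- `s` is a solution of the linear cellular automaton determined by `α`. -/
def IsSol {G : Type*} [Group G] (α : ℕ → (G →₀ ℂ)) (s : ℕ → G → ℂ) : Prop :=
  ∀ t, s (t + 1) = conv (α t) (s t)

/-- Convolution on a group `Q` of an arbitrary (in practice finitely supported)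
kernel `b` with a function `f`. -/
noncomputable def convQ {Q : Type*} [Group Q] (b : Q → ℂ) (f : Q → ℂ) : Q → ℂ :=
  fun x => ∑ᶠ y : Q, b y * f (y⁻¹ * x)

/-- `(r_H a)([g]) = ∑_{h ∈ H} a (g * h)`. -/
noncomputable def rH {G : Type*} [Group G] (H : Subgroup G) [H.Normal] (a : G →₀ ℂ) :
    G ⧸ H → ℂ :=
  fun x => ∑ᶠ h : H, a (Quotient.out x * (h : G))

/-- `s` is a solution of the quotient automaton on `G ⧸ H` determined by `r_H ∘ α`. -/
def IsSolQ {G : Type*} [Group G] (H : Subgroup G) [H.Normal] (α : ℕ → (G →₀ ℂ))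
    (s : ℕ → G ⧸ H → ℂ) : Prop :=
  ∀ t, s (t + 1) = convQ (rH H (α t)) (s t)

/-- `s` is an `H`-periodic sequence of states. -/
def IsPeriodic {G : Type*} [Group G] (H : Subgroup G) (s : ℕ → G → ℂ) : Prop :=
  ∀ (t : ℕ) (g h : G), h ∈ H → s t (g * h) = s t g

/-- The pullback of a sequence of states on `G ⧸ H` to a sequence of states on `G`. -/
def pullback {G : Type*} [Group G] (H : Subgroup G) [H.Normal]
    (s : ℕ → G ⧸ H → ℂ) : ℕ → G → ℂ :=
  fun t g => s t (QuotientGroup.mk g)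

open Classical in
/-- `r_H a` is the push-forward of `a`: it sums `a` over the fibres of the quotient map. -/
theorem rH_eq_sum_filter {G : Type*} [Group G] (H : Subgroup G) [H.Normal] (a : G →₀ ℂ)
    (x : G ⧸ H) : rH H a x = ∑ g ∈ a.support with (QuotientGroup.mk g : G ⧸ H) = x, a g := by
  have hinj : Function.Injective fun h : H => Quotient.out x * (h : G) :=
    fun _ _ hh => Subtype.ext (mul_left_cancel hh)
  unfold rH
  rw [← finsum_mem_range (f := a) hinj]
  apply finsum_mem_eq_sum_of_inter_support_eq
  have hout : (QuotientGroup.mk (Quotient.out x) : G ⧸ H) = x := QuotientGroup.out_eq' x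
  ext g
  have hrange : g ∈ Set.range (fun h : H => Quotient.out x * (h : G)) ↔
      (QuotientGroup.mk g : G ⧸ H) = x := by
    constructor
    · rintro ⟨h, rfl⟩
      exact (QuotientGroup.mk_mul_of_mem _ h.2).trans hout
    · intro hg
      exact ⟨⟨(Quotient.out x)⁻¹ * g, QuotientGroup.eq.1 (hout.trans hg.symm)⟩,
        mul_inv_cancel_left _ _⟩
  simp only [Set.mem_inter_iff, hrange, Function.mem_support, Finset.mem_coe, Finset.mem_filter,
    Finsupp.mem_support_iff]
  tauto

/-- Convolution commutes with pulling back along the quotient map. -/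
theorem convQ_rH_mk {G : Type*} [Group G] (H : Subgroup G) [H.Normal] (a : G →₀ ℂ)
    (f : G ⧸ H → ℂ) (g : G) :
    convQ (rH H a) f (QuotientGroup.mk g) =
      conv a (fun k => f (QuotientGroup.mk k)) g := by
  classical
  unfold convQ conv
  rw [finsum_eq_sum_of_support_subset (s := a.support.image (QuotientGroup.mk : G → G ⧸ H))]
  · rw [← Finset.sum_fiberwise_of_maps_to
      (g := (QuotientGroup.mk : G → G ⧸ H)) fun _ => Finset.mem_image_of_mem _]
    refine Finset.sum_congr rfl fun y _ => ?_
    rw [rH_eq_sum_filter, Finset.sum_mul]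
    refine Finset.sum_congr rfl fun k hk => ?_
    rw [← (Finset.mem_filter.1 hk).2, ← QuotientGroup.mk_inv, ← QuotientGroup.mk_mul]
  · intro y hy
    have hne := left_ne_zero_of_mul (Function.mem_support.1 hy)
    rw [rH_eq_sum_filter] at hne
    obtain ⟨k, hk, -⟩ := Finset.exists_ne_zero_of_sum_ne_zero hne
    exact Finset.mem_coe.2 (Finset.mem_image.2 ⟨k, Finset.mem_filter.1 hk⟩)

theorem pullback_injective {G : Type*} [Group G] (H : Subgroup G) [H.Normal] :
    Function.Injective (pullback H) := by
  intro s s' h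
  funext t x
  obtain ⟨g, rfl⟩ := QuotientGroup.mk_surjective x
  exact congrFun (congrFun h t) g

theorem isSol_pullback_iff {G : Type*} [Group G] (H : Subgroup G) [H.Normal]
    (α : ℕ → (G →₀ ℂ)) (s : ℕ → G ⧸ H → ℂ) : IsSol α (pullback H s) ↔ IsSolQ H α s := by
  refine forall_congr' fun t => ?_
  rw [funext_iff, funext_iff, QuotientGroup.mk_surjective.forall]
  exact forall_congr' fun g => by rw [convQ_rH_mk]; rfl

theorem isPeriodic_pullback {G : Type*} [Group G] (H : Subgroup G) [H.Normal]
    (s : ℕ → G ⧸ H → ℂ) : IsPeriodic H (pullback H s) :=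
  fun t g _ hh => congrArg (s t) (QuotientGroup.mk_mul_of_mem g hh)

theorem IsPeriodic.exists_pullback_eq {G : Type*} [Group G] {H : Subgroup G} [H.Normal]
    {u : ℕ → G → ℂ} (hu : IsPeriodic H u) : ∃ s, pullback H s = u := by
  refine ⟨fun t x => u t (Quotient.out x), ?_⟩
  funext t g
  obtain ⟨h, hh⟩ := QuotientGroup.mk_out_eq_mul H g
  exact (congrArg (u t) hh).trans (hu t g h h.2)

/-- the pullback map is a ℂ-linear bijection from the solutions of the
automaton on `G ⧸ H` determined by `r_H ∘ α` onto the `H`-periodic solutions of the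
automaton on `G` determined by `α`. -/
theorem stmt_1 {G : Type*} [Group G] (H : Subgroup G) [H.Normal] (α : ℕ → (G →₀ ℂ)) :
    (∀ s, IsSolQ H α s → IsSol α (pullback H s) ∧ IsPeriodic H (pullback H s)) ∧
    (∀ s s', IsSolQ H α s → IsSolQ H α s' → pullback H s = pullback H s' → s = s') ∧
    (∀ u, IsSol α u → IsPeriodic H u → ∃ s, IsSolQ H α s ∧ pullback H s = u) ∧
    (∀ s s' : ℕ → G ⧸ H → ℂ, pullback H (s + s') = pullback H s + pullback H s') ∧
    (∀ (c : ℂ) (s : ℕ → G ⧸ H → ℂ), pullback H (c • s) = c • pullback H s) := by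
  refine ⟨fun s hs => ⟨(isSol_pullback_iff H α s).2 hs, isPeriodic_pullback H s⟩,
    fun s s' _ _ h => pullback_injective H h, fun u hu hper => ?_, fun _ _ => rfl, fun _ _ => rfl⟩
  obtain ⟨s, rfl⟩ := hper.exists_pullback_eq
  exact ⟨s, (isSol_pullback_iff H α s).1 hu, rfl⟩
end

section
/- (Abel–Liouville formula for linear cellular automata) Let G be a group and α = (α^{(t)})_{t ∈ ℕ} a sequence of finitely supported functions α^{(t)} : G → ℂ. If s is a solution of the associated linear cellular automaton whose initial state s^{(0)} is finitely supported (so that each s^{(t)} is finitely supported), then for every t ∈ ℕ: ∑_{g ∈ G} s^{(t)}(g) = (∏_{τ=0}^{t-1} ∑_{h ∈ G} α^{(τ)}(h)) · ∑_{g ∈ G} s^{(0)}(g). -/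
open scoped BigOperators Classical

theorem support_mul_left_translate_finite {G : Type*} [Group G] {f : G → ℂ}
    (hf : (Function.support f).Finite) (c : ℂ) (h : G) :
    (Function.support fun g => c * f (h⁻¹ * g)).Finite :=
  (hf.preimage (mul_right_injective h⁻¹).injOn).subset fun _ hg => right_ne_zero_of_mul hg

theorem conv_support_finite {G : Type*} [Group G] (a : G →₀ ℂ) {f : G → ℂ}
    (hf : (Function.support f).Finite) : (Function.support (conv a f)).Finite := by
  refine (a.support.finite_toSet.biUnion fun h _ =>
    support_mul_left_translate_finite hf (a h) h).subset fun g hg => ?_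
  obtain ⟨h, hh, hne⟩ := Finset.exists_ne_zero_of_sum_ne_zero hg
  exact Set.mem_biUnion hh hne

theorem finsum_conv {G : Type*} [Group G] (a : G →₀ ℂ) {f : G → ℂ}
    (hf : (Function.support f).Finite) :
    ∑ᶠ g, conv a f g = (∑ h ∈ a.support, a h) * ∑ᶠ g, f g := by
  unfold conv
  rw [finsum_sum_comm _ _ fun h _ => support_mul_left_translate_finite hf (a h) h,
    Finset.sum_mul]
  refine Finset.sum_congr rfl fun h _ => ?_
  rw [← finsum_comp_equiv (Equiv.mulLeft h⁻¹) (f := f), mul_finsum]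
  rfl

/-- Abel–Liouville: for a solution `s` with finitely supported initial state,
each state is finitely supported and the total sum of the state at time `t` equals
`(∏_{τ<t} ∑_h α^{(τ)}(h))` times the total sum of the initial state. -/
theorem stmt_6 {G : Type*} [Group G] (α : ℕ → (G →₀ ℂ)) (s : ℕ → G → ℂ)
    (hs : IsSol α s) (h0 : (Function.support (s 0)).Finite) :
    ∀ t : ℕ, (Function.support (s t)).Finite ∧
      ∑ᶠ g : G, s t g =
        (∏ τ ∈ Finset.range t, ∑ h ∈ (α τ).support, α τ h) * ∑ᶠ g : G, s 0 g := by
  intro t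
  induction t with
  | zero => simpa using h0
  | succ t ih =>
    rw [hs t]
    refine ⟨conv_support_finite (α t) ih.1, ?_⟩
    rw [finsum_conv (α t) ih.1, ih.2, Finset.prod_range_succ]
    ring
end

section
/- Let G be a group and α = (α^{(t)})_{t ∈ ℕ} a sequence of finitely supported functions α^{(t)} : G → ℂ. In the space of all sequences ℕ → (G → ℂ) equipped with the topology of pointwise convergence on ℕ × G, the set of solutions of the associated linear cellular automaton whose initial state is finitely supported is dense in the set of all solutions. -/
open scoped BigOperators Classical

/-- The solution of the linear cellular automaton with initial state `f`. -/
noncomputable def evolve {G : Type*} [Group G] (α : ℕ → (G →₀ ℂ)) (f : G → ℂ) : ℕ → G → ℂ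
  | 0 => f
  | t + 1 => conv (α t) (evolve α f t)

theorem isSol_evolve {G : Type*} [Group G] (α : ℕ → (G →₀ ℂ)) (f : G → ℂ) :
    IsSol α (evolve α f) :=
  fun _ => rfl

theorem IsSol.eq_evolve {G : Type*} [Group G] {α : ℕ → (G →₀ ℂ)} {s : ℕ → G → ℂ}
    (hs : IsSol α s) : s = evolve α (s 0) := by
  funext t
  induction t with
  | zero => rfl
  | succ t ih => rw [hs t, ih, evolve]

theorem continuous_conv {G : Type*} [Group G] (a : G →₀ ℂ) : Continuous (conv a) := by
  unfold conv
  fun_prop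

theorem continuous_evolve {G : Type*} [Group G] (α : ℕ → (G →₀ ℂ)) :
    Continuous (evolve α) := by
  refine continuous_pi fun t => ?_
  induction t with
  | zero => exact continuous_id
  | succ t ih => exact (continuous_conv (α t)).comp ih

/-- Finitely supported functions are dense for pointwise convergence. -/
theorem dense_setOf_finite_support (X : Type*) :
    Dense {f : X → ℂ | (Function.support f).Finite} := by
  intro f
  have hlim : Filter.Tendsto (fun S : Finset X => (S : Set X).indicator f) Filter.atTop
      (nhds f) := by
    refine tendsto_pi_nhds.2 fun x => tendsto_const_nhds.congr' ?_
    filter_upwards [Filter.eventually_ge_atTop {x}] with S hS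
    exact (Set.indicator_of_mem (by simpa using hS) f).symm
  exact mem_closure_of_tendsto hlim <| Filter.Eventually.of_forall fun S =>
    S.finite_toSet.subset Set.support_indicator_subset

/-- in the product topology (pointwise convergence on `ℕ × G`) on the space
of sequences of states, the solutions with finitely supported initial state are dense in
the set of all solutions. -/
theorem stmt_8 {G : Type*} [Group G] (α : ℕ → (G →₀ ℂ)) :
    {s : ℕ → G → ℂ | IsSol α s} ⊆
      closure {s : ℕ → G → ℂ | IsSol α s ∧ (Function.support (s 0)).Finite} := by
  intro s hs
  rw [IsSol.eq_evolve hs]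
  exact map_mem_closure (continuous_evolve α) (dense_setOf_finite_support G (s 0))
    fun f hf => ⟨isSol_evolve α f, hf⟩
end

section
/- Let G be a group and α = (α^{(t)})_{t ∈ ℕ} a sequence of finitely supported functions α^{(t)} : G → ℂ. Call a solution of the associated linear cellular automaton periodic if it is H-periodic for some normal subgroup H of G of finite index. Then the set of periodic solutions is dense in the set of all solutions (in the topology of pointwise convergence on ℕ × G) if and only if G is residually finite, i.e. for every g ∈ G with g ≠ e there exists a normal subgroup H of G of finite index with g ∉ H. -/
open scoped BigOperators Classical

/-- The solution of the automaton with initial state `f`. -/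
noncomputable def solOf {G : Type*} [Group G] (α : ℕ → (G →₀ ℂ)) (f : G → ℂ) : ℕ → G → ℂ
  | 0 => f
  | t + 1 => conv (α t) (solOf α f t)

theorem isSol_solOf {G : Type*} [Group G] (α : ℕ → (G →₀ ℂ)) (f : G → ℂ) :
    IsSol α (solOf α f) :=
  fun _ => rfl

theorem IsSol.eq_solOf {G : Type*} [Group G] {α : ℕ → (G →₀ ℂ)} {s : ℕ → G → ℂ}
    (hs : IsSol α s) : s = solOf α (s 0) := by
  funext t
  induction t with
  | zero => rfl
  | succ t ih => rw [hs t, ih, solOf]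

theorem continuous_solOf {G : Type*} [Group G] (α : ℕ → (G →₀ ℂ)) : Continuous (solOf α) := by
  refine continuous_pi fun t => ?_
  induction t with
  | zero => exact continuous_id
  | succ t ih => exact (continuous_conv (α t)).comp ih

theorem isPeriodic_solOf {G : Type*} [Group G] (α : ℕ → (G →₀ ℂ)) {H : Subgroup G} {f : G → ℂ}
    (hf : ∀ g h : G, h ∈ H → f (g * h) = f g) : IsPeriodic H (solOf α f) := by
  intro t
  induction t with
  | zero => exact hf
  | succ t ih =>
    intro g h hh
    simp only [solOf, conv, ← mul_assoc, ih _ h hh]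

/-- In a residually finite group, a finite set embeds into some finite quotient. -/
theorem exists_normal_finiteIndex_injOn {G : Type*} [Group G]
    (hG : ∀ g : G, g ≠ 1 → ∃ H : Subgroup G, H.Normal ∧ H.FiniteIndex ∧ g ∉ H) (F : Finset G) :
    ∃ H : Subgroup G, H.Normal ∧ H.FiniteIndex ∧
      Function.Injective fun x : F => (QuotientGroup.mk x.1 : G ⧸ H) := by
  have hG' : ∀ g : G, ∃ H : Subgroup G, H.Normal ∧ H.FiniteIndex ∧ (g ∈ H → g = 1) := by
    intro g
    by_cases hg : g = 1
    · exact ⟨⊤, inferInstance, inferInstance, fun _ => hg⟩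
    · obtain ⟨H, hn, hi, hgH⟩ := hG g hg
      exact ⟨H, hn, hi, fun h => absurd h hgH⟩
  choose K hn hi hK using hG'
  refine ⟨⨅ p : F × F, K (p.1.1⁻¹ * p.2.1), Subgroup.normal_iInf_normal fun _ => hn _,
    Subgroup.finiteIndex_iInf fun _ => hi _, fun x y hxy => Subtype.ext ?_⟩
  have hmem := Subgroup.mem_iInf.1 (QuotientGroup.eq.1 hxy) (x, y)
  exact inv_mul_eq_one.1 (hK _ hmem)

/-- In a residually finite group, the periodic functions are dense. -/
theorem dense_periodic {G : Type*} [Group G]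
    (hG : ∀ g : G, g ≠ 1 → ∃ H : Subgroup G, H.Normal ∧ H.FiniteIndex ∧ g ∉ H) :
    Dense {f : G → ℂ | ∃ H : Subgroup G, H.Normal ∧ H.FiniteIndex ∧
      ∀ g h : G, h ∈ H → f (g * h) = f g} := by
  intro f
  refine mem_closure_iff.2 fun U hU hfU => ?_
  obtain ⟨F, u, hu, hFU⟩ := isOpen_pi_iff.1 hU f hfU
  obtain ⟨H, hn, hi, hinj⟩ := exists_normal_finiteIndex_injOn hG F
  refine ⟨fun g => Function.extend (fun x : F => (QuotientGroup.mk x.1 : G ⧸ H))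
    (fun x => f x) 0 g, hFU fun x hx => ?_, H, hn, hi, fun g h hh => ?_⟩
  · have hval := hinj.extend_apply (fun x : F => f x) 0 ⟨x, hx⟩
    simpa only [hval] using (hu x hx).2
  · simp only [QuotientGroup.mk_mul_of_mem g hh]

/-- the periodic solutions (those `H`-periodic for some normal subgroup `H`
of finite index) are dense in the set of all solutions, in the topology of pointwise
convergence on `ℕ × G`, if and only if `G` is residually finite. -/
theorem stmt_9 {G : Type*} [Group G] (α : ℕ → (G →₀ ℂ)) :
    ({s : ℕ → G → ℂ | IsSol α s} ⊆
        closure {s : ℕ → G → ℂ | IsSol α s ∧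
          ∃ H : Subgroup G, H.Normal ∧ H.FiniteIndex ∧ IsPeriodic H s}) ↔
      (∀ g : G, g ≠ 1 → ∃ H : Subgroup G, H.Normal ∧ H.FiniteIndex ∧ g ∉ H) := by
  constructor
  · intro hdense g hg
    have hmem := hdense (isSol_solOf α (Pi.single 1 1))
    have hopen : IsOpen {s : ℕ → G → ℂ | s 0 1 ≠ s 0 g} :=
      isOpen_ne_fun (by fun_prop) (by fun_prop)
    obtain ⟨s, hne, -, H, hn, hi, hper⟩ := mem_closure_iff.1 hmem _ hopen (by simp [solOf, hg])
    refine ⟨H, hn, hi, fun hgH => hne ?_⟩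
    simpa using (hper 0 1 g hgH).symm
  · intro hG s hs
    have hs' : s = solOf α (s 0) := IsSol.eq_solOf hs
    rw [hs']
    refine closure_mono ?_ (image_closure_subset_closure_image (continuous_solOf α)
      (Set.mem_image_of_mem _ (dense_periodic hG (s 0))))
    rintro _ ⟨f, ⟨H, hn, hi, hf⟩, rfl⟩
    exact ⟨isSol_solOf α f, H, hn, hi, isPeriodic_solOf α hf⟩
end

section
/- Let G be a discrete abelian group (written additively) and α = (α^{(t)})_{t ∈ ℕ} a sequence of finitely supported functions α^{(t)} : G → ℂ. Let k be a ℂ-subalgebra of the algebra Map(ℕ, ℂ) of complex sequences (with pointwise operations), closed under the shift σ(x)(t) = x(t+1), containing the constant sequences and containing the sequence t ↦ α^{(t)}(g) for every g ∈ G. Then the k-subalgebra of Map(ℕ, ℂ) generated by all sequences t ↦ s^{(t)}(g), where g ranges over G and s ranges over all solutions of the recurrence s^{(t+1)} = α^{(t)} ⋆ s^{(t)} that are H-periodic for some subgroup H ≤ G of finite index, is equal to the k-subalgebra of Map(ℕ, ℂ) generated by the sequences t ↦ ∏_{τ=0}^{t−1} (∑_{h ∈ G} α^{(τ)}(h) χ(h)),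 where χ ranges over all finite-order group homomorphisms χ : G → ℂ* (i.e. homomorphisms all of whose values are roots of unity of bounded order). -/
/-- The kernel of a character all of whose values are `n`-th roots of unity has finite index. -/
lemma AddChar.exists_finiteIndex_of_pow_eq_one {G : Type*} [AddCommGroup G] (χ : AddChar G ℂ)
    {n : ℕ} (hn : 0 < n) (h : ∀ g, χ g ^ n = 1) :
    ∃ H : AddSubgroup G, H.FiniteIndex ∧ ∀ g ∈ H, χ g = 1 := by
  have : NeZero n := ⟨hn.ne'⟩
  let φ : G →+ Additive (rootsOfUnity n ℂ) :=
    AddMonoidHom.mk' (fun g => Additive.ofMul (rootsOfUnity.mkOfPowEq (χ g) (h g))) fun a b => by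
      apply Additive.toMul.injective
      ext
      simp [AddChar.map_add_eq_mul]
  have : Finite (Additive (rootsOfUnity n ℂ)) :=
    inferInstanceAs (Finite (rootsOfUnity n ℂ))
  refine ⟨φ.ker, inferInstance, fun g hg => ?_⟩
  have h1 : rootsOfUnity.mkOfPowEq (χ g) (h g) = 1 := congrArg Additive.toMul hg
  simpa using congrArg (fun u : rootsOfUnity n ℂ => ((u : ℂˣ) : ℂ)) h1

/-- A function periodic under a finite-index subgroup is a finite linear combination of characters
of finite order. -/
lemma exists_eq_sum_addChar_of_periodic.{u} {G : Type u} [AddCommGroup G] (H : AddSubgroup G)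
    [H.FiniteIndex] (f : G → ℂ) (hf : ∀ g, ∀ h ∈ H, f (g + h) = f g) :
    ∃ (ι : Type u) (_ : Fintype ι) (c : ι → ℂ) (χ : ι → AddChar G ℂ),
      (∀ i, ∃ n : ℕ, 0 < n ∧ ∀ g, χ i g ^ n = 1) ∧ ∀ g, f g = ∑ i, c i * χ i g := by
  classical
  have : Finite (G ⧸ H) := AddSubgroup.finite_quotient_of_finiteIndex
  let _ : Fintype (G ⧸ H) := Fintype.ofFinite _
  let F : G ⧸ H → ℂ := Quotient.lift f fun a b hab => by
    have hab' : -a + b ∈ H := QuotientAddGroup.leftRel_apply.mp hab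
    simpa using (hf a _ hab').symm
  let B := AddChar.complexBasis (G ⧸ H)
  refine ⟨AddChar (G ⧸ H) ℂ, inferInstance, fun ψ => B.repr F ψ,
    fun ψ => ψ.compAddMonoidHom (QuotientAddGroup.mk' H), fun ψ => ?_, fun g => ?_⟩
  · refine ⟨Fintype.card (G ⧸ H), Fintype.card_pos, fun g => ?_⟩
    rw [← AddChar.map_nsmul_eq_pow, AddChar.compAddMonoidHom_apply, map_nsmul, card_nsmul_eq_zero,
      AddChar.map_zero_eq_one]
  · have := congrFun (B.sum_repr F) (g : G ⧸ H)
    rw [Finset.sum_apply] at this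
    simpa [B, F] using this.symm

/-- A solution is determined by its initial value. If that is a linear combination of characters,
then so is the solution at all times, with explicit coefficients. -/
lemma solution_eq_sum_addChar {G ι : Type*} [AddCommGroup G] [Fintype ι] (α : ℕ → (G →₀ ℂ))
    (s : ℕ → G → ℂ)
    (hs : ∀ (t : ℕ) (g : G), s (t + 1) g = ∑ h ∈ (α t).support, α t h * s t (g - h))
    (c : ι → ℂ) (χ : ι → AddChar G ℂ) (h0 : ∀ g, s 0 g = ∑ i, c i * χ i g) (t : ℕ) (g : G) :
    s t g = ∑ i, c i * χ i g *
      ∏ τ ∈ Finset.range t, ∑ h ∈ (α τ).support, α τ h * (χ i)⁻¹ h := by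
  induction t generalizing g with
  | zero => simpa using h0 g
  | succ t ih =>
    simp only [hs, ih, Finset.prod_range_succ, Finset.mul_sum]
    rw [Finset.sum_comm]
    refine Finset.sum_congr rfl fun i _ => Finset.sum_congr rfl fun h _ => ?_
    rw [sub_eq_add_neg, AddChar.map_add_eq_mul, AddChar.inv_apply]
    ring

/-- for a discrete abelian group `G` and a shift-closed ℂ-subalgebra `k` of
the algebra of sequences containing the coefficient sequences of `α`, the `k`-subalgebra of
sequences generated by the coordinate sequences of all solutions that are `H`-periodic for
some finite-index subgroup `H ≤ G` equals the `k`-subalgebra generated by the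
hypergeometric sequences `t ↦ ∏_{τ<t} ∑_h α^{(τ)}(h) χ(h)`, where `χ` runs over the
finite-order characters `χ : G → ℂ*`. -/
theorem stmt_15 {G : Type*} [AddCommGroup G] (α : ℕ → (G →₀ ℂ))
    (k : Subalgebra ℂ (ℕ → ℂ))
    (hshift : ∀ x ∈ k, (fun t => x (t + 1)) ∈ k)
    (halpha : ∀ g : G, (fun t => α t g) ∈ k) :
    Algebra.adjoin ℂ ((k : Set (ℕ → ℂ)) ∪
        {x : ℕ → ℂ | ∃ s : ℕ → G → ℂ,
          (∀ (t : ℕ) (g : G), s (t + 1) g = ∑ h ∈ (α t).support, α t h * s t (g - h)) ∧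
          (∃ H : AddSubgroup G, H.FiniteIndex ∧
            ∀ (t : ℕ) (g : G), ∀ h ∈ H, s t (g + h) = s t g) ∧
          ∃ g : G, x = fun t => s t g}) =
      Algebra.adjoin ℂ ((k : Set (ℕ → ℂ)) ∪
        {x : ℕ → ℂ | ∃ χ : AddChar G ℂ, (∃ n : ℕ, 0 < n ∧ ∀ g : G, χ g ^ n = 1) ∧
          x = fun t => ∏ τ ∈ Finset.range t, ∑ h ∈ (α τ).support, α τ h * χ h}) := by
  apply le_antisymm
  · refine Algebra.adjoin_le (Set.union_subset
      (Set.subset_union_left.trans Algebra.subset_adjoin) ?_)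
    rintro x ⟨s, hs, ⟨H, hH, hper⟩, g, rfl⟩
    obtain ⟨ι, _, c, χ, hχ, h0⟩ := exists_eq_sum_addChar_of_periodic H (s 0) (hper 0)
    have hx : (fun t => s t g) = ∑ i, (c i * χ i g) • fun t : ℕ =>
        ∏ τ ∈ Finset.range t, ∑ h ∈ (α τ).support, α τ h * (χ i)⁻¹ h := by
      ext t
      rw [solution_eq_sum_addChar α s hs c χ h0 t g, Finset.sum_apply]
      rfl
    rw [hx]
    refine Subalgebra.sum_mem _ fun i _ => Subalgebra.smul_mem _ ?_ _
    refine Algebra.subset_adjoin (Or.inr ⟨(χ i)⁻¹, ?_, rfl⟩)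
    obtain ⟨n, hn, h⟩ := hχ i
    exact ⟨n, hn, fun g => by rw [AddChar.inv_apply, h]⟩
  · refine Algebra.adjoin_le (Set.union_subset
      (Set.subset_union_left.trans Algebra.subset_adjoin) ?_)
    rintro x ⟨χ, ⟨n, hn, h⟩, rfl⟩
    obtain ⟨H, hH, hker⟩ := χ.exists_finiteIndex_of_pow_eq_one hn h
    refine Algebra.subset_adjoin (Or.inr ⟨fun t g => χ (-g) *
      ∏ τ ∈ Finset.range t, ∑ h ∈ (α τ).support, α τ h * χ h, fun t g => ?_,
      ⟨H, hH, fun t g h hh => ?_⟩, 0, by simp⟩)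
    · simp only [Finset.prod_range_succ, Finset.mul_sum]
      refine Finset.sum_congr rfl fun h _ => ?_
      rw [neg_sub, sub_eq_add_neg, AddChar.map_add_eq_mul]
      ring
    · simp only [neg_add, AddChar.map_add_eq_mul, hker _ (H.neg_mem hh), mul_one]
end

section
/- For all natural numbers t and b with b ≤ t, the binomial coefficient satisfies the integral identity C(t, b) = (2^{t−1}/π) · ∫_0^{2π} cos((t−2b)θ) · cos^t(θ) dθ, where t−2b is taken as an integer. -/
open scoped Real

theorem integral_cos_int_mul (n : ℤ) :
    ∫ θ in (0 : ℝ)..(2 * π), Real.cos (n * θ) = if n = 0 then 2 * π else 0 := by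
  split_ifs with h
  · simp [h]
  · have hn : (n : ℝ) ≠ 0 := Int.cast_ne_zero.mpr h
    rw [intervalIntegral.integral_comp_mul_left _ hn, integral_cos, mul_zero, Real.sin_zero, sub_zero,
      show (n : ℝ) * (2 * π) = (2 * n : ℤ) * π by push_cast; ring, Real.sin_int_mul_pi, smul_zero]

theorem integral_cos_int_mul_mul_cos_pow_succ (n : ℤ) (t : ℕ) :
    ∫ θ in (0 : ℝ)..(2 * π), Real.cos (n * θ) * Real.cos θ ^ (t + 1) =
      ((∫ θ in (0 : ℝ)..(2 * π), Real.cos ((n + 1 : ℤ) * θ) * Real.cos θ ^ t) +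
        ∫ θ in (0 : ℝ)..(2 * π), Real.cos ((n - 1 : ℤ) * θ) * Real.cos θ ^ t) / 2 := by
  rw [← intervalIntegral.integral_add
      (Continuous.intervalIntegrable (by fun_prop) _ _)
      (Continuous.intervalIntegrable (by fun_prop) _ _),
    ← intervalIntegral.integral_div]
  congr 1 with θ
  push_cast
  rw [add_mul, sub_mul, one_mul, Real.cos_add, Real.cos_sub]
  ring

theorem integral_cos_int_mul_mul_cos_pow_eq_zero (t : ℕ) {n : ℤ} (hn : (t : ℤ) < n) :
    ∫ θ in (0 : ℝ)..(2 * π), Real.cos (n * θ) * Real.cos θ ^ t = 0 := by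
  induction t generalizing n with
  | zero =>
    simp only [pow_zero, mul_one]
    rw [integral_cos_int_mul, if_neg (by lia)]
  | succ t ih =>
    rw [integral_cos_int_mul_mul_cos_pow_succ, ih (by lia), ih (by lia)]
    simp

theorem integral_cos_int_mul_mul_cos_pow (t b : ℕ) :
    ∫ θ in (0 : ℝ)..(2 * π),
        Real.cos (((t : ℤ) - 2 * b : ℤ) * θ) * Real.cos θ ^ t =
      2 * π * t.choose b / 2 ^ t := by
  induction t generalizing b with
  | zero =>
    simp only [pow_zero, mul_one]
    rw [integral_cos_int_mul]
    cases b with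
    | zero => simp
    | succ b =>
      rw [if_neg (by lia)]
      simp
  | succ t ih =>
    rw [integral_cos_int_mul_mul_cos_pow_succ,
      show ((t + 1 : ℕ) : ℤ) - 2 * b - 1 = t - 2 * b by push_cast; ring, ih b]
    cases b with
    | zero =>
      rw [integral_cos_int_mul_mul_cos_pow_eq_zero t (by push_cast; lia)]
      simp only [Nat.choose_zero_right]
      field_simp
      ring
    | succ b =>
      rw [show ((t + 1 : ℕ) : ℤ) - 2 * (b + 1 : ℕ) + 1 = t - 2 * b by push_cast; ring, ih b,
        Nat.choose_succ_succ]
      push_cast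
      field_simp
      ring



/-- the integral identity
`C(t,b) = (2^{t-1}/π) ∫₀^{2π} cos((t-2b)θ) cosᵗ(θ) dθ` for `b ≤ t`,
where `t - 2b` is taken as an integer. -/
theorem stmt_18 (t b : ℕ) (hb : b ≤ t) :
    (Nat.choose t b : ℝ) =
      (2 : ℝ) ^ ((t : ℤ) - 1) / Real.pi *
        ∫ θ in (0 : ℝ)..(2 * Real.pi),
          Real.cos ((((t : ℤ) - 2 * b : ℤ) : ℝ) * θ) * Real.cos θ ^ t := by
  rw [integral_cos_int_mul_mul_cos_pow, zpow_sub₀ two_ne_zero, zpow_natCast, zpow_one]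
  field_simp
end

section
/- For all natural numbers t, b, T with b ≤ t and T > 2t + 1, the binomial coefficient satisfies the finite trigonometric identity C(t, b) = (2^t/T) · ∑_{m=0}^{T−1} cos(2πm(t−2b)/T) · cos^t(2πm/T), where t−2b is taken as an integer. -/
open scoped BigOperators Real

theorem IsPrimitiveRoot.sum_zpow_pow {K : Type*} [Field K] {ζ : K} {T : ℕ}
    (hζ : IsPrimitiveRoot ζ T) (n : ℤ) :
    ∑ m ∈ Finset.range T, (ζ ^ n) ^ m = if (T : ℤ) ∣ n then (T : K) else 0 := by
  split_ifs with h
  · simp [(hζ.zpow_eq_one_iff_dvd n).2 h]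
  · have h1 : ζ ^ n ≠ 1 := fun h1 => h ((hζ.zpow_eq_one_iff_dvd n).1 h1)
    have h2 : (ζ ^ n) ^ T = 1 := by
      rw [← zpow_natCast, ← zpow_mul, mul_comm, zpow_mul, zpow_natCast, hζ.pow_eq_one, one_zpow]
    rw [geom_sum_eq h1, h2, sub_self, zero_div]

/-- Coefficient extraction from `(z + z⁻¹) ^ t` by averaging over the `T`-th roots of unity. -/
theorem IsPrimitiveRoot.sum_zpow_mul_add_inv_pow {K : Type*} [Field K] {ζ : K} {t b T : ℕ}
    (hζ : IsPrimitiveRoot ζ T) (hb : b ≤ t) (hT : 2 * t < T) :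
    ∑ m ∈ Finset.range T, (ζ ^ m) ^ ((t : ℤ) - 2 * b) * (ζ ^ m + (ζ ^ m)⁻¹) ^ t =
      T * t.choose b := by
  have h0 : ζ ≠ 0 := hζ.ne_zero (by lia)
  have expand : ∀ m ∈ Finset.range T,
      (ζ ^ m) ^ ((t : ℤ) - 2 * b) * (ζ ^ m + (ζ ^ m)⁻¹) ^ t =
        ∑ k ∈ Finset.range (t + 1), (ζ ^ (2 * (k : ℤ) - 2 * b)) ^ m * t.choose k := by
    intro m _
    rw [add_pow, Finset.mul_sum]
    refine Finset.sum_congr rfl fun k hk => ?_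
    have hk' : k ≤ t := Nat.lt_succ_iff.1 (Finset.mem_range.1 hk)
    have hz : ζ ^ m ≠ 0 := pow_ne_zero _ h0
    rw [← mul_assoc, ← mul_assoc]
    congr 1
    rw [← zpow_natCast (ζ ^ (2 * (k : ℤ) - 2 * b)), ← zpow_mul, mul_comm _ (m : ℤ), zpow_mul,
      zpow_natCast, inv_pow, ← zpow_natCast (ζ ^ m) k, ← zpow_natCast (ζ ^ m) (t - k),
      ← zpow_neg, ← zpow_add₀ hz, ← zpow_add₀ hz]
    congr 1
    lia
  rw [Finset.sum_congr rfl expand, Finset.sum_comm]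
  simp_rw [← Finset.sum_mul, hζ.sum_zpow_pow]
  rw [Finset.sum_eq_single b]
  · simp
  · intro k hk hkb
    have hk' : k ≤ t := Nat.lt_succ_iff.1 (Finset.mem_range.1 hk)
    rw [if_neg, zero_mul]
    intro hd
    have := Int.eq_zero_of_abs_lt_dvd hd (abs_lt.2 ⟨by lia, by lia⟩)
    lia
  · intro h
    exact absurd (Finset.mem_range.2 (Nat.lt_succ_of_le hb)) h

theorem Complex.re_exp_zpow_mul_add_inv_pow (x : ℝ) (n : ℤ) (t : ℕ) :
    (exp (x * I) ^ n * (exp (x * I) + (exp (x * I))⁻¹) ^ t).re =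
      2 ^ t * (Real.cos (n * x) * Real.cos x ^ t) := by
  have h1 : exp (x * I) + (exp (x * I))⁻¹ = ((2 * Real.cos x : ℝ) : ℂ) := by
    rw [← exp_neg, ← neg_mul, ← two_cos]
    push_cast
    rfl
  have h2 : exp (x * I) ^ n = exp ((n * x : ℝ) * I) := by
    rw [← exp_int_mul]
    push_cast
    rw [mul_assoc]
  rw [h1, h2, ← ofReal_pow, re_mul_ofReal, exp_ofReal_mul_I_re]
  ring

/-- the finite trigonometric identity
`C(t,b) = (2^t/T) ∑_{m=0}^{T-1} cos(2πm(t-2b)/T) cosᵗ(2πm/T)` for `b ≤ t` and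
`T > 2t + 1`, where `t - 2b` is taken as an integer. -/
theorem stmt_19 (t b T : ℕ) (hb : b ≤ t) (hT : 2 * t + 1 < T) :
    (Nat.choose t b : ℝ) =
      2 ^ t / (T : ℝ) * ∑ m ∈ Finset.range T,
        Real.cos (2 * Real.pi * m * (((t : ℤ) - 2 * b : ℤ) : ℝ) / T) *
          Real.cos (2 * Real.pi * m / T) ^ t := by
  have hT0 : T ≠ 0 := by lia
  have hT' : (T : ℝ) ≠ 0 := Nat.cast_ne_zero.2 hT0
  have key := congrArg Complex.re
    ((Complex.isPrimitiveRoot_exp T hT0).sum_zpow_mul_add_inv_pow hb (by lia))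
  have hterm : ∀ m ∈ Finset.range T,
      ((Complex.exp (2 * π * Complex.I / T) ^ m) ^ ((t : ℤ) - 2 * b) *
        (Complex.exp (2 * π * Complex.I / T) ^ m +
          (Complex.exp (2 * π * Complex.I / T) ^ m)⁻¹) ^ t).re =
      2 ^ t * (Real.cos (2 * Real.pi * m * (((t : ℤ) - 2 * b : ℤ) : ℝ) / T) *
          Real.cos (2 * Real.pi * m / T) ^ t) := by
    intro m _
    have hpow : Complex.exp (2 * π * Complex.I / T) ^ m =
        Complex.exp ((2 * π * m / T : ℝ) * Complex.I) := by
      rw [← Complex.exp_nat_mul]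
      push_cast
      congr 1
      ring
    rw [hpow, Complex.re_exp_zpow_mul_add_inv_pow]
    congr 3
    ring
  rw [Complex.re_sum, Finset.sum_congr rfl hterm, ← Finset.mul_sum] at key
  have hre : ((T : ℂ) * (t.choose b : ℂ)).re = (T : ℝ) * t.choose b := by
    rw [← Nat.cast_mul, Complex.natCast_re, Nat.cast_mul]
  rw [hre] at key
  rw [div_mul_eq_mul_div, key, mul_div_cancel_left₀ _ hT']
end
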